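/- Let B = (b_{iℓ}) be an n×2 integer matrix of rank 2 with both column sums equal to zero, with rows b_1, …, b_n ∈ ℤ². In the polynomial ring R = ℚ[y_{11}, y_{12}, …, y_{n1}, y_{n2}], define for ℓ = 1, 2 the polynomials H_ℓ(t) = ∏_{i : b_{iℓ} > 0} (y_{i1} + y_{i2}·t)^{b_{iℓ}} − ∏_{i : b_{iℓ} < 0} (y_{i1} + y_{i2}·t)^{−b_{iℓ}} ∈ R[t]. For 1 ≤ r < s ≤ n, set ν_{rs} = min(|b_{r1}·b_{s2}|, |b_{r2}·b_{s1}|) if b_{r1}·b_{s1} < 0 and b_{r2}·b_{s2} < 0, and ν_{rs} = 0 otherwise. Then the product ∏_{1 ≤ r < s ≤ n} (y_{r1}·y_{s2} − y_{r2}·y_{s1})^{ν_{rs}} divides the resultant Res_t(H_1, H_2) in R. -/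

import Mathlib

open Polynomial

/-- The Sylvester matrix of two univariate polynomials `p` and `q`, regarded as
polynomials of degree (at most) `m` and `n` respectively: a square matrix of size
`n + m`, whose first `n` rows are the shifted coefficient sequences of `p` and whose
last `m` rows are the shifted coefficient sequences of `q`. -/
def sylvesterMatrix {R : Type*} [CommRing R] (m n : ℕ) (p q : R[X]) :
    Matrix (Fin (n + m)) (Fin (n + m)) R :=
  Matrix.of fun i j =>
    if (i : ℕ) < n then
      (if (i : ℕ) ≤ (j : ℕ) then p.coeff ((j : ℕ) - (i : ℕ)) else 0)
    else
      (if (i : ℕ) - n ≤ (j : ℕ) then q.coeff ((j : ℕ) - ((i : ℕ) - n)) else 0)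

/-- The Sylvester resultant of two univariate polynomials `p` and `q` of degrees
(at most) `m` and `n`: the determinant of their Sylvester matrix. -/
def sylvesterResultant {R : Type*} [CommRing R] (m n : ℕ) (p q : R[X]) : R :=
  (sylvesterMatrix m n p q).det

/-- For an `n × 2` integer matrix `B`, the polynomial
`H_ℓ(t) = ∏_{i : b_{iℓ} > 0} (y_{i1} + y_{i2}·t)^{b_{iℓ}}
        − ∏_{i : b_{iℓ} < 0} (y_{i1} + y_{i2}·t)^{−b_{iℓ}}`
with coefficients in `ℚ[y_{11}, y_{12}, …, y_{n1}, y_{n2}]`. -/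
noncomputable def chowH {n : ℕ} (B : Matrix (Fin n) (Fin 2) ℤ) (ℓ : Fin 2) :
    Polynomial (MvPolynomial (Fin n × Fin 2) ℚ) :=
  (∏ i ∈ Finset.univ.filter fun i => 0 < B i ℓ,
      (C (MvPolynomial.X (i, 0)) + C (MvPolynomial.X (i, 1)) * X) ^ (B i ℓ).toNat) -
  (∏ i ∈ Finset.univ.filter fun i => B i ℓ < 0,
      (C (MvPolynomial.X (i, 0)) + C (MvPolynomial.X (i, 1)) * X) ^ (-(B i ℓ)).toNat)

/-- The exponent `ν_{rs}`: equal to `min(|b_{r1}·b_{s2}|, |b_{r2}·b_{s1}|)` if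
`b_{r1}·b_{s1} < 0` and `b_{r2}·b_{s2} < 0`, and `0` otherwise. -/
def chowNu {n : ℕ} (B : Matrix (Fin n) (Fin 2) ℤ) (r s : Fin n) : ℕ :=
  if B r 0 * B s 0 < 0 ∧ B r 1 * B s 1 < 0 then
    min (B r 0 * B s 1).natAbs (B r 1 * B s 0).natAbs
  else 0

/-- If the `(i, j)` entry of a matrix is divisible by `x ^ e` with `q * e ≥ α i - β j`, then the
determinant is divisible by `x ^ N` whenever `q * N ≤ ∑ α - ∑ β`. -/
theorem pow_dvd_det_of_weights {R ι : Type*} [CommRing R] [Fintype ι] [DecidableEq ι]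
    (M : Matrix ι ι R) (x : R) (α β : ι → ℕ) {q N : ℕ} (hq : 0 < q)
    (hM : ∀ i j, ∃ e, x ^ e ∣ M i j ∧ α i ≤ β j + q * e)
    (hN : q * N + ∑ j, β j ≤ ∑ i, α i) : x ^ N ∣ M.det := by
  choose e he hαβ using hM
  rw [Matrix.det_apply]
  refine Finset.dvd_sum fun σ _ => ?_
  rw [Units.smul_def, zsmul_eq_mul]
  refine Dvd.dvd.mul_left ?_ _
  refine dvd_trans ?_ (Finset.prod_dvd_prod_of_dvd _ _ fun i _ => he (σ i) i)
  rw [Finset.prod_pow_eq_pow_sum]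
  refine pow_dvd_pow x ?_
  have h : ∑ i, α (σ i) ≤ ∑ i, (β i + q * e (σ i) i) :=
    Finset.sum_le_sum fun i _ => hαβ (σ i) i
  rw [Equiv.sum_comp σ α, Finset.sum_add_distrib, ← Finset.mul_sum] at h
  exact Nat.le_of_mul_le_mul_left (by omega) hq

theorem two_mul_sum_range_min {b n : ℕ} (h : b ≤ n) :
    2 * ∑ k ∈ Finset.range n, min k b + b * (b + 1) = 2 * (n * b) := by
  induction n, h using Nat.le_induction with
  | base =>
    have h₁ : ∑ k ∈ Finset.range b, min k b = ∑ k ∈ Finset.range b, k :=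
      Finset.sum_congr rfl fun k hk => min_eq_left (Finset.mem_range.1 hk).le
    have h₂ := Finset.sum_range_id_mul_two b
    rw [h₁, mul_comm 2, h₂]
    cases b with
    | zero => rfl
    | succ b => simp only [Nat.add_sub_cancel]; ring
  | succ n hn ih =>
    rw [Finset.sum_range_succ, min_eq_right hn]
    linarith

/-- A lower bound for the order of vanishing of the resultant when the Newton polygons of both
polynomials lie above segments of slope `-p / q` that meet the axis at `a` and `b`. -/
theorem pow_dvd_sylvesterResultant_of_slope {R : Type*} [CommRing R] {x : R} {f g : R[X]}
    {m n a b p q N : ℕ} (ham : a ≤ m) (hbn : b ≤ n) (hq : 0 < q) (hN : q * N ≤ p * (a * b))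
    (hf : ∀ i, ∃ e, x ^ e ∣ f.coeff i ∧ p * (a - i) ≤ q * e)
    (hg : ∀ i, ∃ e, x ^ e ∣ g.coeff i ∧ p * (b - i) ≤ q * e) :
    x ^ N ∣ sylvesterResultant m n f g := by
  refine pow_dvd_det_of_weights _ x
    (fun i : Fin (n + m) => p * if (i : ℕ) < n then a + min (i : ℕ) b else b + min ((i : ℕ) - n) a)
    (fun j : Fin (n + m) => p * min (j : ℕ) (a + b)) hq (fun i j => ?_) ?_
  · have key : ∀ {A B E k : ℕ}, A ≤ B + k → p * k ≤ q * E → p * A ≤ p * B + q * E := by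
      intro A B E k h₁ h₂
      nlinarith [Nat.mul_le_mul_left p h₁]
    simp only [sylvesterMatrix, Matrix.of_apply]
    split_ifs with h₁ h₂ h₂
    · obtain ⟨e, he, hpe⟩ := hf ((j : ℕ) - i)
      exact ⟨e, he, key (by omega) hpe⟩
    · exact ⟨p * (a + min (i : ℕ) b), dvd_zero _,
        (Nat.le_mul_of_pos_left _ hq).trans (Nat.le_add_left _ _)⟩
    · obtain ⟨e, he, hpe⟩ := hg ((j : ℕ) - (i - n))
      exact ⟨e, he, key (by omega) hpe⟩
    · exact ⟨p * (b + min ((i : ℕ) - n) a), dvd_zero _,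
        (Nat.le_mul_of_pos_left _ hq).trans (Nat.le_add_left _ _)⟩
  · rw [← Finset.mul_sum, ← Finset.mul_sum,
      Fin.sum_univ_eq_sum_range
        (fun i => if i < n then a + min i b else b + min (i - n) a) (n + m),
      Finset.sum_range_add, Fin.sum_univ_eq_sum_range (fun j => min j (a + b)) (n + m)]
    have h₁ : ∑ i ∈ Finset.range n, (if i < n then a + min i b else b + min (i - n) a) =
        n * a + ∑ i ∈ Finset.range n, min i b := by
      rw [Finset.sum_congr rfl fun i hi => if_pos (Finset.mem_range.1 hi)]
      simp [Finset.sum_add_distrib]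
    have h₂ : ∑ i ∈ Finset.range m,
        (if n + i < n then a + min (n + i) b else b + min (n + i - n) a) =
        m * b + ∑ i ∈ Finset.range m, min i a := by
      simp [Finset.sum_add_distrib]
    rw [h₁, h₂]
    have h₃ := two_mul_sum_range_min hbn
    have h₄ := two_mul_sum_range_min ham
    have h₅ := two_mul_sum_range_min (show a + b ≤ n + m by omega)
    have h₆ : a * b + ∑ j ∈ Finset.range (n + m), min j (a + b) =
        n * a + ∑ i ∈ Finset.range n, min i b + (m * b + ∑ i ∈ Finset.range m, min i a) := by
      linarith
    rw [← h₆, mul_add]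
    omega

theorem pow_dvd_sylvesterResultant_of_coeff {R : Type*} [CommRing R] {x : R} {f g : R[X]}
    {m n a b c d : ℕ} (ham : a ≤ m) (hbn : b ≤ n) (hac : a ≤ c) (hbd : b ≤ d)
    (hf : ∀ i < a, x ^ (c - i) ∣ f.coeff i) (hg : ∀ i < b, x ^ (d - i) ∣ g.coeff i) :
    x ^ min (a * d) (b * c) ∣ sylvesterResultant m n f g := by
  rcases Nat.eq_zero_or_pos a with rfl | ha
  · simp
  rcases Nat.eq_zero_or_pos b with rfl | hb
  · simp
  have key : ∀ {p q k l : ℕ} {h : R[X]}, p * k ≤ q * l → q ≤ p →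
      (∀ i < k, x ^ (l - i) ∣ h.coeff i) →
      ∀ i, ∃ e, x ^ e ∣ h.coeff i ∧ p * (k - i) ≤ q * e := by
    intro p q k l h h₁ h₂ h₃ i
    rcases lt_or_ge i k with hi | hi
    · refine ⟨l - i, h₃ i hi, ?_⟩
      rw [Nat.mul_sub, Nat.mul_sub]
      have := Nat.mul_le_mul_right i h₂
      omega
    · exact ⟨0, by simp, by simp [Nat.sub_eq_zero_of_le hi]⟩
  rcases le_total (b * c) (a * d) with h | h
  · rw [min_eq_right h]
    exact pow_dvd_sylvesterResultant_of_slope (p := c) (q := a) ham hbn ha (by nlinarith)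
      (key (mul_comm c a).le hac hf) (key (by linarith) hac hg)
  · rw [min_eq_left h]
    exact pow_dvd_sylvesterResultant_of_slope (p := d) (q := b) ham hbn hb (by nlinarith)
      (key (by linarith) hbd hf) (key (mul_comm d b).le hbd hg)

theorem sylvesterMatrix_eq_transpose_sylvester {R : Type*} [CommRing R] {m n : ℕ} {f g : R[X]}
    (hf : f.natDegree ≤ m) (hg : g.natDegree ≤ n) :
    sylvesterMatrix m n f g = (sylvester g f n m).transpose := by
  have key : ∀ {k : ℕ} {h : R[X]}, h.natDegree ≤ k → ∀ i j : ℕ,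
      (if i ≤ j then h.coeff (j - i) else 0) =
        if i ≤ j ∧ j ≤ i + k then h.coeff (j - i) else 0 := by
    intro k h hk i j
    by_cases hj : j ≤ i + k
    · simp [hj]
    · rw [coeff_eq_zero_of_natDegree_lt (by omega)]
      simp
  ext i j
  induction i using Fin.addCases with
  | left i => simpa [sylvesterMatrix, sylvester, -Fin.val_fin_le] using key hf i j
  | right i =>
    have h : n + (i : ℕ) ≤ j + n ↔ (i : ℕ) ≤ j := by omega
    simpa [sylvesterMatrix, sylvester, h] using key hg i j

theorem sylvesterResultant_eq_resultant {R : Type*} [CommRing R] {m n : ℕ} {f g : R[X]}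
    (hf : f.natDegree ≤ m) (hg : g.natDegree ≤ n) :
    sylvesterResultant m n f g = resultant g f n m := by
  rw [sylvesterResultant, sylvesterMatrix_eq_transpose_sylvester hf hg, Matrix.det_transpose,
    resultant]

theorem map_sylvesterResultant {R S : Type*} [CommRing R] [CommRing S] (φ : R →+* S) (m n : ℕ)
    (f g : R[X]) :
    sylvesterResultant m n (f.map φ) (g.map φ) = φ (sylvesterResultant m n f g) := by
  rw [sylvesterResultant, sylvesterResultant, RingHom.map_det]
  congr 1
  ext i j
  simp [sylvesterMatrix, apply_ite φ]

theorem resultant_taylor_of_natDegree_le {R : Type*} [CommRing R] {m n : ℕ} {f g : R[X]}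
    (hf : f.natDegree ≤ m) (hg : g.natDegree ≤ n) (r : R) :
    resultant (f.taylor r) (g.taylor r) m n = resultant f g m n := by
  rcases hf.lt_or_eq with hf' | rfl
  · rcases hg.lt_or_eq with hg' | rfl
    · rw [resultant_eq_zero_of_lt_lt _ _ _ _ hf' hg',
        resultant_eq_zero_of_lt_lt _ _ _ _ (by rwa [natDegree_taylor])
          (by rwa [natDegree_taylor])]
    · obtain ⟨k, rfl⟩ := Nat.exists_eq_add_of_le hf
      have hc : (g.taylor r).coeff g.natDegree = g.coeff g.natDegree := by
        rw [coeff_natDegree, ← leadingCoeff_taylor r g, leadingCoeff, natDegree_taylor]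
      rw [resultant_add_left_deg _ _ _ _ _ le_rfl,
        resultant_add_left_deg _ _ _ _ _ (natDegree_taylor f r).le, hc]
      have := resultant_taylor f g r
      rw [natDegree_taylor, natDegree_taylor] at this
      rw [this]
  · obtain ⟨k, rfl⟩ := Nat.exists_eq_add_of_le hg
    have hc : (f.taylor r).coeff f.natDegree = f.coeff f.natDegree := by
      rw [coeff_natDegree, ← leadingCoeff_taylor r f, leadingCoeff, natDegree_taylor]
    rw [resultant_add_right_deg _ _ _ _ _ le_rfl,
      resultant_add_right_deg _ _ _ _ _ (natDegree_taylor g r).le, hc]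
    have := resultant_taylor f g r
    rw [natDegree_taylor, natDegree_taylor] at this
    rw [this]

theorem sylvesterResultant_taylor {R : Type*} [CommRing R] {m n : ℕ} {f g : R[X]}
    (hf : f.natDegree ≤ m) (hg : g.natDegree ≤ n) (r : R) :
    sylvesterResultant m n (f.taylor r) (g.taylor r) = sylvesterResultant m n f g := by
  rw [sylvesterResultant_eq_resultant hf hg,
    sylvesterResultant_eq_resultant (by rwa [natDegree_taylor]) (by rwa [natDegree_taylor]),
    resultant_taylor_of_natDegree_le hg hf]

theorem pow_sub_dvd_coeff_linear_pow_mul {R : Type*} [CommRing R] {D x : R} (hx : D ∣ x) (δ : R)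
    (c : ℕ) (Q : R[X]) (i : ℕ) : D ^ (c - i) ∣ ((C x + C δ * X) ^ c * Q).coeff i := by
  induction c generalizing i with
  | zero => simp
  | succ c ih =>
    have h : (C x + C δ * X) ^ (c + 1) * Q =
        C x * ((C x + C δ * X) ^ c * Q) + C δ * (((C x + C δ * X) ^ c * Q) * X) := by ring
    rw [h, coeff_add, coeff_C_mul, coeff_C_mul]
    refine dvd_add ?_ (Dvd.dvd.mul_left ?_ _)
    · refine (pow_dvd_pow D (show c + 1 - i ≤ 1 + (c - i) by omega)).trans ?_
      rw [pow_add, pow_one]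
      exact mul_dvd_mul hx (ih i)
    · cases i with
      | zero => simp
      | succ i =>
        rw [coeff_mul_X, Nat.add_sub_add_right]
        exact ih i

/-- The case of the bracket bound in which the first linear form has invertible slope. -/
theorem bracket_pow_dvd_sylvesterResultant_of_isUnit {R : Type*} [CommRing R] {α β γ δ : R}
    (hβ : IsUnit β) {m n a b c d : ℕ} {P Q P' Q' f g : R[X]}
    (hf : f = (C α + C β * X) ^ a * P + (C γ + C δ * X) ^ c * Q)
    (hg : g = (C α + C β * X) ^ b * P' + (C γ + C δ * X) ^ d * Q')
    (hfm : f.natDegree ≤ m) (hgn : g.natDegree ≤ n) (hm : min a c ≤ m) (hn : min b d ≤ n)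
    (h : a ≤ c ∨ b ≤ d) :
    (α * δ - β * γ) ^ min (a * d) (b * c) ∣ sylvesterResultant m n f g := by
  obtain ⟨β', hβ'⟩ := hβ.exists_right_inv
  have hx : (α * δ - β * γ) ∣ γ - δ * (α * β') :=
    ⟨-β', by linear_combination (-γ) * hβ'⟩
  have hcoeff : ∀ {k l : ℕ} {U V p : R[X]},
      p = (C α + C β * X) ^ k * U + (C γ + C δ * X) ^ l * V →
      ∀ i < min k l, (α * δ - β * γ) ^ (l - i) ∣ (p.taylor (-(α * β'))).coeff i := by
    intro k l U V p hp i hi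
    have h₁ : (C α + C β * X : R[X]).taylor (-(α * β')) = C β * X := by
      have : (C β * C β' : R[X]) = 1 := by rw [← C_mul, hβ', C_1]
      simp only [map_add, taylor_mul, taylor_C, taylor_X, map_neg, map_mul]
      linear_combination (-C α) * this
    have h₂ : (C γ + C δ * X : R[X]).taylor (-(α * β')) = C (γ - δ * (α * β')) + C δ * X := by
      simp only [map_add, taylor_mul, taylor_C, taylor_X, map_neg, map_mul, map_sub]
      ring
    rw [hp, map_add, taylor_mul, taylor_mul, taylor_pow, taylor_pow, h₁, h₂, coeff_add, mul_pow,
      mul_right_comm, coeff_mul_X_pow', if_neg (by omega), zero_add]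
    exact pow_sub_dvd_coeff_linear_pow_mul hx δ l _ i
  have key := pow_dvd_sylvesterResultant_of_coeff hm hn (min_le_right a c) (min_le_right b d)
    (hcoeff hf) (hcoeff hg)
  rw [sylvesterResultant_taylor hfm hgn] at key
  refine (pow_dvd_pow _ ?_).trans key
  rw [Nat.mul_comm, Nat.mul_comm b c]
  rcases h with h | h
  · rw [min_eq_left h]
    rcases le_total b d with h' | h'
    · rw [min_eq_left h', mul_comm d, mul_comm c]
    · rw [min_eq_right h', mul_comm d]
      exact le_min (min_le_left _ _)
        ((min_le_left _ _).trans (by rw [mul_comm d]; exact Nat.mul_le_mul_right d h))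
  · rw [min_eq_left h]
    rcases le_total a c with h' | h'
    · rw [min_eq_left h', mul_comm d, mul_comm c]
    · rw [min_eq_right h', mul_comm b]
      exact le_min ((min_le_right _ _).trans (Nat.mul_le_mul_left c h)) (min_le_right _ _)

/-- If `f` and `g` lie in the ideals `(L ^ a, M ^ c)` and `(L ^ b, M ^ d)`, where `L`, `M` are
linear forms whose bracket is prime, then that bracket divides the resultant to the power
`min (a * d) (b * c)`. -/
theorem bracket_pow_dvd_sylvesterResultant {R : Type*} [CommRing R] [IsDomain R] {α β γ δ : R}
    (hD : Prime (α * δ - β * γ)) (hβ : ¬ (α * δ - β * γ) ∣ β)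
    {m n a b c d : ℕ} {P Q P' Q' f g : R[X]}
    (hf : f = (C α + C β * X) ^ a * P + (C γ + C δ * X) ^ c * Q)
    (hg : g = (C α + C β * X) ^ b * P' + (C γ + C δ * X) ^ d * Q')
    (hfm : f.natDegree ≤ m) (hgn : g.natDegree ≤ n) (hm : min a c ≤ m) (hn : min b d ≤ n)
    (h : a ≤ c ∨ b ≤ d) :
    (α * δ - β * γ) ^ min (a * d) (b * c) ∣ sylvesterResultant m n f g := by
  let φ := algebraMap R (Localization.Away β)
  have key := bracket_pow_dvd_sylvesterResultant_of_isUnit (α := φ α) (β := φ β) (γ := φ γ)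
    (δ := φ δ) (IsLocalization.Away.algebraMap_isUnit β)
    (P := P.map φ) (Q := Q.map φ) (P' := P'.map φ) (Q' := Q'.map φ)
    (f := f.map φ) (g := g.map φ) (by simp [hf]) (by simp [hg])
    (natDegree_map_le.trans hfm) (natDegree_map_le.trans hgn) hm hn h
  rw [map_sylvesterResultant] at key
  obtain ⟨z, hz⟩ := key
  obtain ⟨k, w, hw⟩ := IsLocalization.Away.surj β z
  have h₁ : φ (β ^ k * sylvesterResultant m n f g) =
      φ ((α * δ - β * γ) ^ min (a * d) (b * c) * w) := by
    simp only [map_mul, map_pow, map_sub, hz]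
    rw [← show z * φ β ^ k = φ w from hw]
    ring
  obtain ⟨l, hl⟩ := IsLocalization.Away.exists_of_eq β h₁
  refine hD.pow_dvd_of_dvd_mul_left _ (a := β ^ l * β ^ k) ?_ ⟨β ^ l * w, ?_⟩
  · rw [← pow_add]
    exact fun hdvd => hβ (hD.dvd_of_dvd_pow hdvd)
  · rw [mul_assoc, hl]
    ring

section Brackets

variable {n : ℕ}

/-- The bracket `y_{r1}·y_{s2} − y_{r2}·y_{s1}`. -/
noncomputable def bracket (r s : Fin n) : MvPolynomial (Fin n × Fin 2) ℚ :=
  MvPolynomial.X (r, 0) * MvPolynomial.X (s, 1) - MvPolynomial.X (r, 1) * MvPolynomial.X (s, 0)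

theorem bracket_swap (r s : Fin n) : bracket s r = -bracket r s := by
  simp only [bracket]
  ring

theorem eval_bracket (v : Fin n × Fin 2 → ℚ) (r s : Fin n) :
    MvPolynomial.eval v (bracket r s) = v (r, 0) * v (s, 1) - v (r, 1) * v (s, 0) := by
  simp [bracket]

theorem irreducible_bracket {r s : Fin n} (h : r ≠ s) : Irreducible (bracket r s) := by
  have hs : Irreducible (MvPolynomial.X (s, 1) : MvPolynomial (Fin n × Fin 2) ℚ) :=
    MvPolynomial.X_prime.irreducible
  have key : bracket r s = MvPolynomial.X (s, 1) * MvPolynomial.X (r, 0) +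
      -(MvPolynomial.X (r, 1) * MvPolynomial.X (s, 0)) := by
    simp only [bracket]
    ring
  rw [key]
  refine MvPolynomial.irreducible_mul_X_add _ _ _ (MvPolynomial.X_ne_zero _) ?_ ?_ ?_
  · simp [MvPolynomial.vars_X]
  · rw [MvPolynomial.vars_neg]
    intro hmem
    have := MvPolynomial.vars_mul _ _ hmem
    simp [MvPolynomial.vars_X, h] at this
  · rw [hs.isRelPrime_iff_not_dvd, dvd_neg]
    intro hdvd
    have := map_dvd (MvPolynomial.eval fun k : Fin n × Fin 2 => if k = (s, 1) then (0 : ℚ) else 1)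
      hdvd
    simp [h] at this

theorem not_bracket_dvd_X (r s : Fin n) (k : Fin n × Fin 2) :
    ¬ bracket r s ∣ MvPolynomial.X k := by
  intro hdvd
  have := map_dvd (MvPolynomial.eval fun _ => (1 : ℚ)) hdvd
  simp [eval_bracket] at this

theorem not_bracket_dvd_bracket {r s r' s' : Fin n} (h' : r' ≠ s') (hr : r' ≠ r) (hs : r' ≠ s) :
    ¬ bracket r s ∣ bracket r' s' := by
  intro hdvd
  have := map_dvd
    (MvPolynomial.eval fun k : Fin n × Fin 2 => if k.1 = r' ↔ k.2 = 1 then (1 : ℚ) else 0) hdvd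
  simp [eval_bracket, hr.symm, hs.symm, h'.symm] at this

theorem isRelPrime_bracket {r s r' s' : Fin n} (h : r < s) (h' : r' < s')
    (hne : (r, s) ≠ (r', s')) : IsRelPrime (bracket r s) (bracket r' s') := by
  rw [(irreducible_bracket h.ne).isRelPrime_iff_not_dvd]
  by_cases hr' : r' ≠ r ∧ r' ≠ s
  · exact not_bracket_dvd_bracket h'.ne hr'.1 hr'.2
  · rw [← neg_neg (bracket r' s'), dvd_neg, ← bracket_swap]
    refine not_bracket_dvd_bracket h'.ne' ?_ ?_ <;> grind

end Brackets

section ChowH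

variable {n : ℕ}

/-- The linear form `y_{i1} + y_{i2}·t`. -/
noncomputable def chowL (i : Fin n) : (MvPolynomial (Fin n × Fin 2) ℚ)[X] :=
  C (MvPolynomial.X (i, 0)) + C (MvPolynomial.X (i, 1)) * X

theorem natDegree_chowL_le (i : Fin n) : (chowL i).natDegree ≤ 1 := by
  rw [chowL, add_comm]
  exact natDegree_linear_le

theorem natDegree_prod_chowL_pow_le (e : Fin n → ℕ) (t : Finset (Fin n)) :
    (∏ i ∈ t, chowL i ^ e i).natDegree ≤ ∑ i, e i := by
  refine (natDegree_prod_le _ _).trans ?_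
  refine (Finset.sum_le_sum fun i _ => ?_).trans
    (Finset.sum_le_sum_of_subset (Finset.subset_univ t))
  exact (natDegree_pow_le_of_le (e i) (natDegree_chowL_le i)).trans (mul_one _).le

theorem sum_toNat_neg {b : Fin n → ℤ} (hb : ∑ i, b i = 0) :
    ∑ i, (-b i).toNat = ∑ i, (b i).toNat := by
  zify
  rw [← sub_eq_zero, ← Finset.sum_sub_distrib, ← neg_eq_zero, ← hb, ← Finset.sum_neg_distrib]
  exact Finset.sum_congr rfl fun i _ => by omega

theorem natDegree_chowH_le (B : Matrix (Fin n) (Fin 2) ℤ) (ℓ : Fin 2) (hsum : ∑ i, B i ℓ = 0) :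
    (chowH B ℓ).natDegree ≤ ∑ i, (B i ℓ).toNat := by
  refine (natDegree_sub_le _ _).trans (max_le ?_ ?_)
  · exact natDegree_prod_chowL_pow_le (fun i => (B i ℓ).toNat) _
  · rw [← sum_toNat_neg hsum]
    exact natDegree_prod_chowL_pow_le (fun i => (-B i ℓ).toNat) _

theorem exists_chowH_eq (B : Matrix (Fin n) (Fin 2) ℤ) (ℓ : Fin 2) {r s : Fin n}
    (h : B r ℓ * B s ℓ < 0) :
    ∃ P Q, chowH B ℓ = chowL r ^ (B r ℓ).natAbs * P + chowL s ^ (B s ℓ).natAbs * Q := by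
  have hpos : ∀ {i}, 0 < B i ℓ → chowL i ^ (B i ℓ).natAbs ∣
      ∏ i ∈ Finset.univ.filter fun i => 0 < B i ℓ, chowL i ^ (B i ℓ).toNat := by
    intro i hi
    rw [show (B i ℓ).natAbs = (B i ℓ).toNat by omega]
    exact Finset.dvd_prod_of_mem (fun i => chowL i ^ (B i ℓ).toNat) (by simpa using hi)
  have hneg : ∀ {i}, B i ℓ < 0 → chowL i ^ (B i ℓ).natAbs ∣
      ∏ i ∈ Finset.univ.filter fun i => B i ℓ < 0, chowL i ^ (-B i ℓ).toNat := by
    intro i hi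
    rw [show (B i ℓ).natAbs = (-B i ℓ).toNat by omega]
    exact Finset.dvd_prod_of_mem (fun i => chowL i ^ (-B i ℓ).toNat) (by simpa using hi)
  have hH : chowH B ℓ = (∏ i ∈ Finset.univ.filter fun i => 0 < B i ℓ, chowL i ^ (B i ℓ).toNat) -
      ∏ i ∈ Finset.univ.filter fun i => B i ℓ < 0, chowL i ^ (-B i ℓ).toNat := rfl
  rw [hH]
  rcases mul_neg_iff.1 h with ⟨hr, hs⟩ | ⟨hr, hs⟩
  · obtain ⟨P, hP⟩ := hpos hr
    obtain ⟨Q, hQ⟩ := hneg hs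
    exact ⟨P, -Q, by rw [hP, hQ]; ring⟩
  · obtain ⟨P, hP⟩ := hneg hr
    obtain ⟨Q, hQ⟩ := hpos hs
    exact ⟨-P, Q, by rw [hP, hQ]; ring⟩

theorem min_natAbs_le_sum_toNat {b : Fin n → ℤ} {r s : Fin n} (h : b r * b s < 0) :
    min (b r).natAbs (b s).natAbs ≤ ∑ i, (b i).toNat := by
  have hle : ∀ j, (b j).toNat ≤ ∑ i, (b i).toNat := fun j =>
    Finset.single_le_sum (f := fun i => (b i).toNat) (fun _ _ => Nat.zero_le _)
      (Finset.mem_univ j)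
  have hr := hle r
  have hs := hle s
  rcases mul_neg_iff.1 h with ⟨h₁, h₂⟩ | ⟨h₁, h₂⟩ <;> omega

theorem bracket_pow_dvd_sylvesterResultant_chowH {B : Matrix (Fin n) (Fin 2) ℤ}
    (hsum : ∀ ℓ : Fin 2, ∑ i, B i ℓ = 0) {r s : Fin n} (hrs : r ≠ s) (h₀ : B r 0 * B s 0 < 0)
    (h₁ : B r 1 * B s 1 < 0)
    (hle : (B r 0).natAbs ≤ (B s 0).natAbs ∨ (B r 1).natAbs ≤ (B s 1).natAbs) :
    bracket r s ^ min (B r 0 * B s 1).natAbs (B r 1 * B s 0).natAbs ∣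
      sylvesterResultant (∑ i, (B i 0).toNat) (∑ i, (B i 1).toNat) (chowH B 0) (chowH B 1) := by
  obtain ⟨P, Q, hPQ⟩ := exists_chowH_eq B 0 h₀
  obtain ⟨P', Q', hPQ'⟩ := exists_chowH_eq B 1 h₁
  rw [Int.natAbs_mul, Int.natAbs_mul]
  exact bracket_pow_dvd_sylvesterResultant (irreducible_bracket hrs).prime
    (not_bracket_dvd_X r s (r, 1)) hPQ hPQ' (natDegree_chowH_le B 0 (hsum 0))
    (natDegree_chowH_le B 1 (hsum 1)) (min_natAbs_le_sum_toNat (b := fun i => B i 0) h₀)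
    (min_natAbs_le_sum_toNat (b := fun i => B i 1) h₁) hle

theorem bracket_pow_chowNu_dvd {B : Matrix (Fin n) (Fin 2) ℤ}
    (hsum : ∀ ℓ : Fin 2, ∑ i, B i ℓ = 0) {r s : Fin n} (hrs : r ≠ s) :
    bracket r s ^ chowNu B r s ∣
      sylvesterResultant (∑ i, (B i 0).toNat) (∑ i, (B i 1).toNat) (chowH B 0) (chowH B 1) := by
  rw [chowNu]
  split_ifs with h
  · by_cases hle : (B r 0).natAbs ≤ (B s 0).natAbs ∨ (B r 1).natAbs ≤ (B s 1).natAbs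
    · exact bracket_pow_dvd_sylvesterResultant_chowH hsum hrs h.1 h.2 hle
    · have key := bracket_pow_dvd_sylvesterResultant_chowH hsum hrs.symm
        (by rw [mul_comm]; exact h.1) (by rw [mul_comm]; exact h.2) (by omega)
      rw [bracket_swap, (Associated.neg_left (Associated.refl _)).pow_pow.dvd_iff_dvd_left,
        min_comm, mul_comm (B s 1), mul_comm (B s 0)] at key
      exact key
  · simp

end ChowH

/-- Let `B = (b_{iℓ})` be an `n × 2` integer matrix of rank `2` with both column sums
zero.  Then the product of the brackets `(y_{r1}·y_{s2} − y_{r2}·y_{s1})^{ν_{rs}}` over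
all pairs `1 ≤ r < s ≤ n` divides the Sylvester resultant `Res_t(H_1, H_2)` in
`ℚ[y_{11}, …, y_{n2}]`, where `H_ℓ` has degree `β_ℓ = Σ_i max(b_{iℓ}, 0)`. -/
theorem brackets_dvd_resultant {n : ℕ} (B : Matrix (Fin n) (Fin 2) ℤ)
    (hrank : B.rank = 2) (hsum : ∀ ℓ : Fin 2, ∑ i, B i ℓ = 0) :
    (∏ r : Fin n, ∏ s ∈ Finset.univ.filter fun s => r < s,
        (MvPolynomial.X (r, 0) * MvPolynomial.X (s, 1) -
          MvPolynomial.X (r, 1) * MvPolynomial.X (s, 0) :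
            MvPolynomial (Fin n × Fin 2) ℚ) ^ chowNu B r s) ∣
      sylvesterResultant (∑ i, (B i 0).toNat) (∑ i, (B i 1).toNat)
        (chowH B 0) (chowH B 1) := by
  rw [Finset.prod_sigma']
  refine Finset.prod_dvd_of_isRelPrime ?_ ?_
  · rintro ⟨r, s⟩ h ⟨r', s'⟩ h' hne
    refine (isRelPrime_bracket (r := r) (s := s) (r' := r') (s' := s') ?_ ?_ ?_).pow
    · simpa using h
    · simpa using h'
    · simpa using hne
  · rintro ⟨r, s⟩ h
    have hrs : r < s := by simpa using h
    exact bracket_pow_chowNu_dvd hsum hrs.ne
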